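/- arXiv:1409.8557 — 3 statements merged into one kernel-verified Lean document; each statement's English description precedes it below -/
import Mathlib

section
/- Assume λ_ε ≥ ‖Xᵀε‖_∞/n and λ > λ_ε, and set L := (λ+λ_ε)/(λ−λ_ε). Then for every β ∈ ℝᵖ with active set S := S_β such that φ̂(L,S) > 0, the Lasso estimator β̂ satisfies ‖X(β̂−β⁰)‖_n² ≤ ‖X(β−β⁰)‖_n² + (λ+λ_ε)²·|S| / φ̂²(L,S). -/
open Finset Matrix

/-- `‖v‖_n = √(vᵀv/n)`. -/
noncomputable def normN {n : ℕ} (v : Fin n → ℝ) : ℝ :=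
  Real.sqrt ((∑ i, v i ^ 2) / n)

/-- `ℓ₁`-norm of a vector. -/
noncomputable def l1norm {p : ℕ} (v : Fin p → ℝ) : ℝ := ∑ j, |v j|

/-- `ℓ_∞`-norm of a vector. -/
noncomputable def lsup {p : ℕ} (v : Fin p → ℝ) : ℝ := ⨆ j, |v j|

/-- `β_S`: the vector `β` with entries outside `S` set to zero. -/
def sub0 {p : ℕ} (S : Finset (Fin p)) (β : Fin p → ℝ) : Fin p → ℝ :=
  fun j => if j ∈ S then β j else 0

/-- The compatibility constant squared `φ̂²(L,S)`. -/
noncomputable def compatSq {n p : ℕ} (X : Matrix (Fin n) (Fin p) ℝ) (L : ℝ)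
    (S : Finset (Fin p)) : ℝ :=
  sInf { r | ∃ β : Fin p → ℝ, l1norm (sub0 S β) = 1 ∧ l1norm (sub0 Sᶜ β) ≤ L ∧
    r = S.card * (normN (X.mulVec (sub0 S β) - X.mulVec (sub0 Sᶜ β))) ^ 2 }

lemma normN_sq {n : ℕ} (v : Fin n → ℝ) : normN v ^ 2 = (v ⬝ᵥ v) / n := by
  rw [normN, Real.sq_sqrt (by positivity)]
  simp [dotProduct, sq]

lemma abs_le_lsup {p : ℕ} (v : Fin p → ℝ) (j : Fin p) : |v j| ≤ lsup v :=
  le_ciSup (f := fun j => |v j|) (Set.finite_range _).bddAbove j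

lemma lsup_nonneg {p : ℕ} (v : Fin p → ℝ) : 0 ≤ lsup v :=
  Real.iSup_nonneg fun _ => abs_nonneg _

lemma l1norm_nonneg {p : ℕ} (v : Fin p → ℝ) : 0 ≤ l1norm v :=
  Finset.sum_nonneg fun _ _ => abs_nonneg _

lemma l1norm_smul {p : ℕ} (c : ℝ) (v : Fin p → ℝ) : l1norm (c • v) = |c| * l1norm v := by
  simp [l1norm, abs_mul, Finset.mul_sum]

lemma l1norm_add_le {p : ℕ} (v w : Fin p → ℝ) : l1norm (v + w) ≤ l1norm v + l1norm w := by
  simp only [l1norm, ← Finset.sum_add_distrib, Pi.add_apply]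
  exact Finset.sum_le_sum fun _ _ => abs_add_le _ _

/-- Hölder's inequality for the pair `ℓ_∞`, `ℓ₁`. -/
lemma dotProduct_le_lsup_mul_l1norm {p : ℕ} (v w : Fin p → ℝ) :
    v ⬝ᵥ w ≤ lsup v * l1norm w := by
  rw [dotProduct, l1norm, Finset.mul_sum]
  refine Finset.sum_le_sum fun j _ => (le_abs_self _).trans ?_
  rw [abs_mul]
  gcongr
  exact abs_le_lsup v j

lemma sub0_add_sub0_compl {p : ℕ} (S : Finset (Fin p)) (v : Fin p → ℝ) :
    sub0 S v + sub0 Sᶜ v = v := by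
  ext j
  by_cases h : j ∈ S <;> simp [sub0, h]

lemma l1norm_eq_sub0_add {p : ℕ} (S : Finset (Fin p)) (v : Fin p → ℝ) :
    l1norm v = l1norm (sub0 S v) + l1norm (sub0 Sᶜ v) := by
  simp only [l1norm, ← Finset.sum_add_distrib]
  refine Finset.sum_congr rfl fun j _ => ?_
  by_cases h : j ∈ S <;> simp [sub0, h]

/-- For `β` supported on `S`, the increase of the `ℓ₁`-norm under a perturbation `u`. -/
lemma l1norm_sub_l1norm_add_le {p : ℕ} {S : Finset (Fin p)} {β : Fin p → ℝ}
    (hβ : ∀ j ∉ S, β j = 0) (u : Fin p → ℝ) :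
    l1norm β - l1norm (β + u) ≤ l1norm (sub0 S u) - l1norm (sub0 Sᶜ u) := by
  simp only [l1norm, ← Finset.sum_sub_distrib, Pi.add_apply]
  refine Finset.sum_le_sum fun j _ => ?_
  by_cases h : j ∈ S
  · have := abs_sub_abs_le_abs_sub (β j) (β j + u j)
    simpa [sub0, h] using this
  · simp [sub0, h, hβ j h]

/-- The first order optimality condition of the Lasso. -/
lemma lasso_dotProduct_le {n p : ℕ} {X : Matrix (Fin n) (Fin p) ℝ} {Y : Fin n → ℝ} {lam : ℝ}
    (hlam : 0 ≤ lam) {βhat : Fin p → ℝ}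
    (hβhat : ∀ β : Fin p → ℝ,
      (normN (Y - X.mulVec βhat)) ^ 2 + 2 * lam * l1norm βhat ≤
        (normN (Y - X.mulVec β)) ^ 2 + 2 * lam * l1norm β)
    (β : Fin p → ℝ) :
    ((Y - X *ᵥ βhat) ⬝ᵥ (X *ᵥ (β - βhat))) / n ≤ lam * (l1norm β - l1norm βhat) := by
  set r := Y - X *ᵥ βhat with hr
  set w := X *ᵥ (β - βhat) with hw
  have step (t : ℝ) (ht0 : 0 < t) (ht1 : t ≤ 1) :
      (r ⬝ᵥ w) / n ≤ lam * (l1norm β - l1norm βhat) + t * ((w ⬝ᵥ w) / n / 2) := by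
    have h := hβhat ((1 - t) • βhat + t • β)
    have hres : Y - X *ᵥ ((1 - t) • βhat + t • β) = r - t • w := by
      rw [hr, hw, mulVec_add, mulVec_smul, mulVec_smul, mulVec_sub]
      module
    have hconv : l1norm ((1 - t) • βhat + t • β) ≤ (1 - t) * l1norm βhat + t * l1norm β := by
      refine (l1norm_add_le _ _).trans_eq ?_
      rw [l1norm_smul, l1norm_smul, abs_of_nonneg (sub_nonneg.2 ht1), abs_of_pos ht0]
    have hsq : (r - t • w) ⬝ᵥ (r - t • w) =
        r ⬝ᵥ r - 2 * t * (r ⬝ᵥ w) + t ^ 2 * (w ⬝ᵥ w) := by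
      simp only [sub_dotProduct, dotProduct_sub, smul_dotProduct, dotProduct_smul, smul_eq_mul,
        dotProduct_comm w r]
      ring
    rw [hres, normN_sq, normN_sq, hsq, add_div, sub_div, mul_div_assoc, mul_div_assoc] at h
    have hpen := mul_le_mul_of_nonneg_left hconv hlam
    refine le_of_mul_le_mul_left ?_ ht0
    linarith
  have hlim : Filter.Tendsto
      (fun t : ℝ => lam * (l1norm β - l1norm βhat) + t * ((w ⬝ᵥ w) / n / 2))
      (nhdsWithin 0 (Set.Ioi 0)) (nhds (lam * (l1norm β - l1norm βhat))) := by
    have : Continuous fun t : ℝ =>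
        lam * (l1norm β - l1norm βhat) + t * ((w ⬝ᵥ w) / n / 2) := by fun_prop
    simpa using this.continuousWithinAt (x := 0) (s := Set.Ioi 0) |>.tendsto
  refine ge_of_tendsto hlim ?_
  filter_upwards [Ioc_mem_nhdsGT one_pos] with t ht using step t ht.1 ht.2

/-- The compatibility inequality, in homogeneous form. -/
lemma sq_l1norm_mul_compatSq_le {n p : ℕ} (X : Matrix (Fin n) (Fin p) ℝ) {L : ℝ}
    {S : Finset (Fin p)} {u : Fin p → ℝ} (hpos : 0 < l1norm (sub0 S u))
    (hcone : l1norm (sub0 Sᶜ u) ≤ L * l1norm (sub0 S u)) :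
    l1norm (sub0 S u) ^ 2 * compatSq X L S ≤ S.card * normN (X *ᵥ u) ^ 2 := by
  set a := l1norm (sub0 S u) with ha
  set v : Fin p → ℝ := a⁻¹ • (sub0 S u - sub0 Sᶜ u) with hv
  have hvS : sub0 S v = a⁻¹ • sub0 S u := by
    ext j
    by_cases h : j ∈ S <;> simp [hv, sub0, h]
  have hvSc : sub0 Sᶜ v = -a⁻¹ • sub0 Sᶜ u := by
    ext j
    by_cases h : j ∈ S <;> simp [hv, sub0, h]
  have hle : compatSq X L S ≤
      S.card * normN (X *ᵥ sub0 S v - X *ᵥ sub0 Sᶜ v) ^ 2 := by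
    refine csInf_le ⟨0, ?_⟩ ⟨v, ?_, ?_, rfl⟩
    · rintro _ ⟨_, _, _, rfl⟩
      positivity
    · rw [hvS, l1norm_smul, abs_of_pos (inv_pos.2 hpos), ← ha, inv_mul_cancel₀ hpos.ne']
    · rw [hvSc, l1norm_smul, abs_neg, abs_of_pos (inv_pos.2 hpos), inv_mul_le_iff₀ hpos]
      linarith
  have hdiff : X *ᵥ sub0 S v - X *ᵥ sub0 Sᶜ v = a⁻¹ • X *ᵥ u := by
    rw [← mulVec_sub, ← mulVec_smul, hvS, hvSc, neg_smul, sub_neg_eq_add, ← smul_add,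
      sub0_add_sub0_compl]
  have hnorm : normN (a⁻¹ • X *ᵥ u) ^ 2 = normN (X *ᵥ u) ^ 2 / a ^ 2 := by
    simp only [normN_sq, smul_dotProduct, dotProduct_smul, smul_eq_mul]
    field_simp
  rw [hdiff, hnorm, ← mul_div_assoc, le_div_iff₀ (by positivity)] at hle
  linarith

theorem lasso_sharp_oracle
    {n p : ℕ} (X : Matrix (Fin n) (Fin p) ℝ) (Y : Fin n → ℝ)
    (β0 : Fin p → ℝ) (ε : Fin n → ℝ) (hε : ε = Y - X.mulVec β0)
    (lam lamε : ℝ) (hlam0 : 0 < lam)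
    (hlamε : lamε ≥ lsup (Xᵀ.mulVec ε) / n)
    (hlam : lam > lamε)
    (L : ℝ) (hL : L = (lam + lamε) / (lam - lamε))
    (βhat : Fin p → ℝ)
    (hβhat : ∀ β : Fin p → ℝ,
      (normN (Y - X.mulVec βhat)) ^ 2 + 2 * lam * l1norm βhat ≤
        (normN (Y - X.mulVec β)) ^ 2 + 2 * lam * l1norm β)
    (β : Fin p → ℝ) (S : Finset (Fin p)) (hS : ∀ j, j ∈ S ↔ β j ≠ 0)
    (hφ : 0 < compatSq X L S) :
    (normN (X.mulVec (βhat - β0))) ^ 2 ≤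
      (normN (X.mulVec (β - β0))) ^ 2 +
        (lam + lamε) ^ 2 * S.card / compatSq X L S := by
  have hlamε0 : 0 ≤ lamε := (div_nonneg (lsup_nonneg _) n.cast_nonneg).trans hlamε
  set u := βhat - β with hu
  set a := l1norm (sub0 S u)
  set b := l1norm (sub0 Sᶜ u)
  set q := normN (X *ᵥ u) ^ 2 with hq
  have hb0 : 0 ≤ b := l1norm_nonneg _
  have hq0 : 0 ≤ q := sq_nonneg _
  have hKKT := lasso_dotProduct_le hlam0.le hβhat β
  have hl1 : l1norm β - l1norm βhat ≤ a - b := by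
    have := l1norm_sub_l1norm_add_le (β := β) (fun j hj => not_not.1 (mt (hS j).2 hj)) u
    rwa [show β + u = βhat by rw [hu]; abel] at this
  have hnoise : (ε ⬝ᵥ (X *ᵥ u)) / n ≤ lamε * (a + b) := by
    rw [dotProduct_mulVec, ← mulVec_transpose]
    calc (Xᵀ *ᵥ ε) ⬝ᵥ u / n ≤ lsup (Xᵀ *ᵥ ε) * l1norm u / n := by
          gcongr
          exact dotProduct_le_lsup_mul_l1norm _ _
      _ = lsup (Xᵀ *ᵥ ε) / n * l1norm u := by ring
      _ ≤ lamε * l1norm u := mul_le_mul_of_nonneg_right hlamε (l1norm_nonneg _)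
      _ = lamε * (a + b) := by rw [l1norm_eq_sub0_add S u]
  have hpolar : normN (X *ᵥ (βhat - β0)) ^ 2 - normN (X *ᵥ (β - β0)) ^ 2 + q =
      2 * (((Y - X *ᵥ βhat) ⬝ᵥ (X *ᵥ (β - βhat))) / n + (ε ⬝ᵥ (X *ᵥ u)) / n) := by
    simp only [hq, hu, hε, normN_sq, mulVec_sub, sub_dotProduct, dotProduct_sub,
      dotProduct_comm (X *ᵥ β) (X *ᵥ βhat), dotProduct_comm (X *ᵥ β0) (X *ᵥ βhat),
      dotProduct_comm (X *ᵥ β0) (X *ᵥ β)]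
    ring
  have hbasic : normN (X *ᵥ (βhat - β0)) ^ 2 - normN (X *ᵥ (β - β0)) ^ 2 + q ≤
      2 * ((lam + lamε) * a - (lam - lamε) * b) := by
    have := mul_le_mul_of_nonneg_left hl1 hlam0.le
    linarith
  have hgap : 0 < lam - lamε := sub_pos.2 hlam
  rcases le_or_gt ((lam + lamε) * a) ((lam - lamε) * b) with h | h
  · have : 0 ≤ (lam + lamε) ^ 2 * S.card / compatSq X L S := by positivity
    linarith
  have ha0 : 0 < a := pos_of_mul_pos_right ((mul_nonneg hgap.le hb0).trans_lt h) (by positivity)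
  have hcone : b ≤ L * a := by
    rw [hL, div_mul_eq_mul_div, le_div_iff₀ hgap]
    linarith
  have hcompat := sq_l1norm_mul_compatSq_le X ha0 hcone
  set φ := compatSq X L S
  have hcard : (0 : ℝ) < S.card :=
    pos_of_mul_pos_left ((mul_pos (pow_pos ha0 2) hφ).trans_le hcompat) hq0
  have hquad : 2 * (lam + lamε) * a ≤ a ^ 2 * φ / S.card + (lam + lamε) ^ 2 * S.card / φ := by
    have : a ^ 2 * φ / S.card + (lam + lamε) ^ 2 * S.card / φ - 2 * (lam + lamε) * a =
        (a * φ - (lam + lamε) * S.card) ^ 2 / (S.card * φ) := by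
      field_simp
      ring
    have : 0 ≤ (a * φ - (lam + lamε) * S.card) ^ 2 / (S.card * φ) := by positivity
    linarith
  have hq_lower : a ^ 2 * φ / S.card ≤ q := by
    rw [div_le_iff₀' hcard]
    exact hcompat
  have := mul_nonneg hgap.le hb0
  linarith
end

section
/- The square-root Lasso residuals satisfy ‖ε̂‖_n ≤ ‖ε‖_n + λ‖β⁰‖₁. Moreover, if a constant λ₀ satisfies λ₀‖ε‖_n ≥ ‖Xᵀε‖_∞/n, and if for some η > 0 the tuning parameter satisfies λ(1−η²) > 2λ₀ and ‖β⁰‖₁ ≤ (‖ε‖_n/(4λ₀))·(1 − η² − 2λ₀/λ), then ‖ε̂‖_n² ≥ η²‖ε‖_n². -/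
open Finset Matrix

lemma normN_nonneg {n : ℕ} (v : Fin n → ℝ) : 0 ≤ normN v :=
  Real.sqrt_nonneg _

lemma l1norm_sub_le {p : ℕ} (v w : Fin p → ℝ) : l1norm (v - w) ≤ l1norm v + l1norm w := by
  rw [l1norm, l1norm, l1norm, ← Finset.sum_add_distrib]
  exact Finset.sum_le_sum fun j _ => abs_sub (v j) (w j)

/-- Lower bound for the squared norm after moving the residual by `X δ`. -/
lemma normN_sub_mulVec_sq_ge {n p : ℕ} (X : Matrix (Fin n) (Fin p) ℝ) (ε : Fin n → ℝ)
    (δ : Fin p → ℝ) :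
    normN ε ^ 2 - 2 * (lsup (Xᵀ.mulVec ε) / n * l1norm δ) ≤ normN (ε - X.mulVec δ) ^ 2 := by
  have hexp : normN (ε - X.mulVec δ) ^ 2
      = normN ε ^ 2 - 2 * ((Xᵀ.mulVec ε ⬝ᵥ δ) / n) + normN (X.mulVec δ) ^ 2 := by
    rw [normN_sq, normN_sq, normN_sq, mulVec_transpose, ← dotProduct_mulVec, sub_dotProduct,
      dotProduct_sub, dotProduct_sub, dotProduct_comm (X.mulVec δ) ε]
    ring
  have hholder : (Xᵀ.mulVec ε ⬝ᵥ δ) / n ≤ lsup (Xᵀ.mulVec ε) / n * l1norm δ := by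
    rw [div_mul_eq_mul_div]
    exact div_le_div_of_nonneg_right (dotProduct_le_lsup_mul_l1norm _ _) (Nat.cast_nonneg n)
  linarith [sq_nonneg (normN (X.mulVec δ))]

theorem sqrt_lasso_residual_bounds
    {n p : ℕ} (X : Matrix (Fin n) (Fin p) ℝ) (Y : Fin n → ℝ)
    (β0 : Fin p → ℝ) (ε : Fin n → ℝ) (hε : ε = Y - X.mulVec β0)
    (lam : ℝ) (hlam0 : 0 < lam)
    (βhat : Fin p → ℝ)
    (hβhat : ∀ β : Fin p → ℝ,
      normN (Y - X.mulVec βhat) + lam * l1norm βhat ≤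
        normN (Y - X.mulVec β) + lam * l1norm β)
    (εhat : Fin n → ℝ) (hεhat : εhat = Y - X.mulVec βhat) :
    normN εhat ≤ normN ε + lam * l1norm β0 ∧
      ∀ lam0 η : ℝ, lam0 * normN ε ≥ lsup (Xᵀ.mulVec ε) / n → 0 < η →
        lam * (1 - η ^ 2) > 2 * lam0 →
        l1norm β0 ≤ (normN ε / (4 * lam0)) * (1 - η ^ 2 - 2 * lam0 / lam) →
        (normN εhat) ^ 2 ≥ η ^ 2 * (normN ε) ^ 2 := by
  have hmin := hβhat β0
  rw [← hεhat, ← hε] at hmin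
  have hb := l1norm_nonneg βhat
  have ha := normN_nonneg εhat
  have he := normN_nonneg ε
  refine ⟨by linarith [mul_nonneg hlam0.le hb], fun lam0 η hdual _ hlam hβ0 => ?_⟩
  rcases he.eq_or_lt with he0 | hepos
  · rw [← he0]
    nlinarith
  have hlam0_nonneg : 0 ≤ lam0 :=
    nonneg_of_mul_nonneg_left
      ((div_nonneg (lsup_nonneg _) (Nat.cast_nonneg n)).trans hdual) hepos
  have hβ0' : 4 * lam0 * l1norm β0 ≤ normN ε * (1 - η ^ 2 - 2 * lam0 / lam) := by
    rcases hlam0_nonneg.eq_or_lt with rfl | hpos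
    · have : 0 < 1 - η ^ 2 := pos_of_mul_pos_right (by linarith) hlam0.le
      simpa using mul_nonneg he this.le
    · have := mul_le_mul_of_nonneg_left hβ0 (by positivity : 0 ≤ 4 * lam0)
      rwa [← mul_assoc, mul_div_cancel₀ _ (by positivity)] at this
  have hβhat_le : l1norm βhat ≤ (normN ε - normN εhat) / lam + l1norm β0 := by
    rw [← sub_le_iff_le_add, le_div_iff₀ hlam0]
    linarith
  have hres : εhat = ε - X.mulVec (βhat - β0) := by
    rw [hεhat, hε, mulVec_sub]
    abel
  have hexp := normN_sub_mulVec_sq_ge X ε (βhat - β0)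
  rw [← hres] at hexp
  have hcross : lsup (Xᵀ.mulVec ε) / n * l1norm (βhat - β0)
      ≤ lam0 * normN ε * ((normN ε - normN εhat) / lam + 2 * l1norm β0) :=
    mul_le_mul hdual (by linarith [l1norm_sub_le βhat β0]) (l1norm_nonneg _)
      (mul_nonneg hlam0_nonneg he)
  have hscaled := mul_le_mul_of_nonneg_left hβ0' he
  have hrem : 0 ≤ lam0 * normN ε * normN εhat / lam := by positivity
  have hid : lam0 * normN ε * ((normN ε - normN εhat) / lam + 2 * l1norm β0)
      = lam0 * normN ε ^ 2 / lam - lam0 * normN ε * normN εhat / lam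
        + normN ε * (4 * lam0 * l1norm β0) / 2 := by ring
  have hid' : normN ε * (normN ε * (1 - η ^ 2 - 2 * lam0 / lam))
      = normN ε ^ 2 - η ^ 2 * normN ε ^ 2 - 2 * (lam0 * normN ε ^ 2 / lam) := by ring
  linarith
end

section
/- Let S ∈ ℕ and for s = 1,…,S let Z_s be nonnegative random variables such that for positive constants H_s and all a > 0, P(Z_s ≥ √(H_s + a)) ≤ exp(−a). Then E max_{1≤s≤S} [Z_s − √(H_s + s·log 2)]₊² ≤ 1, where [x]₊ := max(x,0) denotes the positive part. -/
open MeasureTheory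

lemma lintegral_exp_neg_add_Ioi_zero (c : ℝ) :
    ∫⁻ t in Set.Ioi (0 : ℝ), ENNReal.ofReal (Real.exp (-(c + t))) =
      ENNReal.ofReal (Real.exp (-c)) := by
  have hsplit : ∀ t : ℝ, Real.exp (-(c + t)) = Real.exp (-c) * Real.exp (-t) := fun t => by
    rw [← Real.exp_add]; ring_nf
  have hint : IntegrableOn (fun t : ℝ => Real.exp (-c) * Real.exp (-t)) (Set.Ioi 0) :=
    (integrableOn_exp_neg_Ioi 0).const_mul _
  simp_rw [hsplit]
  rw [← ofReal_integral_eq_lintegral_ofReal hint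
    (Filter.Eventually.of_forall fun t => by positivity), integral_const_mul,
    integral_exp_neg_Ioi]
  simp

lemma lintegral_sq_posPart_sub_sqrt_le {Ω : Type*} [MeasurableSpace Ω] {μ : Measure Ω}
    {X : Ω → ℝ} (hX : Measurable X) {h c : ℝ} (hc : 0 ≤ c) (hhc : 0 ≤ h + c)
    (htail : ∀ a : ℝ, 0 < a →
      μ {ω | X ω ≥ Real.sqrt (h + a)} ≤ ENNReal.ofReal (Real.exp (-a))) :
    ∫⁻ ω, ENNReal.ofReal ((max (X ω - Real.sqrt (h + c)) 0) ^ 2) ∂μ ≤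
      ENNReal.ofReal (Real.exp (-c)) := by
  rw [lintegral_eq_lintegral_meas_le μ (Filter.Eventually.of_forall fun ω => sq_nonneg _)
    (by fun_prop), ← lintegral_exp_neg_add_Ioi_zero]
  refine setLIntegral_mono' measurableSet_Ioi fun t (ht : 0 < t) => ?_
  refine (measure_mono fun ω hω => ?_).trans (htail (c + t) (by linarith))
  have hω' : t ≤ (max (X ω - Real.sqrt (h + c)) 0) ^ 2 := hω
  have hpos : 0 < X ω - Real.sqrt (h + c) := by
    by_contra! hle
    rw [max_eq_right hle] at hω'
    linarith
  rw [max_eq_left hpos.le] at hω'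
  have hs := Real.sqrt_nonneg (h + c)
  refine Real.sqrt_le_iff.mpr ⟨by linarith, ?_⟩
  nlinarith [Real.sq_sqrt hhc, mul_nonneg hs hpos.le]

lemma sum_fin_exp_neg_succ_mul_log_two_le_one (n : ℕ) :
    ∑ s : Fin n, Real.exp (-(((s : ℕ) + 1) * Real.log 2)) ≤ 1 := by
  have hterm : ∀ k : ℕ, Real.exp (-((k + 1) * Real.log 2)) = (1 / 2 : ℝ) ^ (k + 1) := fun k => by
    rw [Real.exp_neg, ← Nat.cast_succ, Real.exp_nat_mul, Real.exp_log two_pos, one_div, inv_pow]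
  simp_rw [hterm]
  rw [Fin.sum_univ_eq_sum_range (fun k => (1 / 2 : ℝ) ^ (k + 1))]
  have hsum : ∑ k ∈ Finset.range n, (1 / 2 : ℝ) ^ (k + 1) = 1 - (1 / 2) ^ n := by
    induction n with
    | zero => simp
    | succ n ih => rw [Finset.sum_range_succ, ih]; ring
  rw [hsum]
  linarith [show (0 : ℝ) ≤ (1 / 2) ^ n by positivity]

theorem expectation_of_positive_parts
    {Ω : Type*} [MeasurableSpace Ω] (μ : Measure Ω) [IsProbabilityMeasure μ]
    (S : ℕ) (Z : Fin S → Ω → ℝ) (H : Fin S → ℝ)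
    (hmeas : ∀ s, Measurable (Z s))
    (hZ : ∀ s ω, 0 ≤ Z s ω)
    (hH : ∀ s, 0 < H s)
    (htail : ∀ s : Fin S, ∀ a : ℝ, 0 < a →
      μ {ω | Z s ω ≥ Real.sqrt (H s + a)} ≤ ENNReal.ofReal (Real.exp (-a))) :
    (∫ ω, (⨆ s : Fin S,
        (max (Z s ω - Real.sqrt (H s + ((s : ℕ) + 1) * Real.log 2)) 0) ^ 2) ∂μ) ≤ 1 := by
  set f : Fin S → Ω → ℝ := fun s ω =>
    (max (Z s ω - Real.sqrt (H s + ((s : ℕ) + 1) * Real.log 2)) 0) ^ 2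
  have hf0 : ∀ s ω, 0 ≤ f s ω := fun s ω => sq_nonneg _
  have hfm : ∀ s, Measurable (f s) := fun s => by
    have := hmeas s
    fun_prop
  have hlint : ∀ s, ∫⁻ ω, ENNReal.ofReal (f s ω) ∂μ ≤
      ENNReal.ofReal (Real.exp (-(((s : ℕ) + 1) * Real.log 2))) := fun s => by
    have hc : 0 ≤ ((s : ℕ) + 1) * Real.log 2 := by positivity
    exact lintegral_sq_posPart_sub_sqrt_le (hmeas s) hc (by linarith [hH s]) (htail s)
  have hfi : ∀ s, Integrable (f s) μ := fun s =>
    ⟨(hfm s).aestronglyMeasurable, (hasFiniteIntegral_iff_ofReal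
      (Filter.Eventually.of_forall (hf0 s))).mpr ((hlint s).trans_lt ENNReal.ofReal_lt_top)⟩
  calc ∫ ω, ⨆ s, f s ω ∂μ ≤ ∫ ω, ∑ s, f s ω ∂μ := by
        refine integral_mono_of_nonneg
          (Filter.Eventually.of_forall fun ω => Real.iSup_nonneg fun s => hf0 s ω)
          (integrable_finsetSum _ fun s _ => hfi s) (Filter.Eventually.of_forall fun ω => ?_)
        exact Real.iSup_le (fun s => Finset.single_le_sum (f := fun s => f s ω)
          (fun s _ => hf0 s ω) (Finset.mem_univ s)) (Finset.sum_nonneg fun s _ => hf0 s ω)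
    _ = ∑ s, ∫ ω, f s ω ∂μ := integral_finsetSum _ fun s _ => hfi s
    _ ≤ ∑ s : Fin S, Real.exp (-(((s : ℕ) + 1) * Real.log 2)) := by
        refine Finset.sum_le_sum fun s _ => ?_
        rw [integral_eq_lintegral_of_nonneg_ae (Filter.Eventually.of_forall (hf0 s))
          (hfm s).aestronglyMeasurable]
        exact ENNReal.toReal_le_of_le_ofReal (Real.exp_pos _).le (hlint s)
    _ ≤ 1 := sum_fin_exp_neg_succ_mul_log_two_le_one S
end
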